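/- For all m ≥ 4, the number r_0(m) satisfies the strict upper bound r_0(m) < (2/m!)·(e·m·(m−1)²/8)^{m−2}. -/

import Mathlib

/-- The union of the hyperplanes of the braid arrangement `B_m` in `ℝ^m`:
`x_i = x_j` for `1 ≤ i < j ≤ m`. -/
def braidUnion (m : ℕ) : Set (Fin m → ℝ) :=
  ⋃ i : Fin m, ⋃ j : Fin m, ⋃ _ : i < j, {x | x i = x j}

/-- The union of the hyperplanes of the arrangement `N_m` in `ℝ^m`:
`x_i + x_j = x_k + x_l` for quadruples of distinct indices `(i,j,k,l)` with
`i < j`, `i < k < l`. -/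
def midUnion (m : ℕ) : Set (Fin m → ℝ) :=
  ⋃ i : Fin m, ⋃ j : Fin m, ⋃ k : Fin m, ⋃ l : Fin m,
    ⋃ _ : i < j, ⋃ _ : i < k, ⋃ _ : k < l, ⋃ _ : j ≠ k, ⋃ _ : j ≠ l,
      {x | x i + x j = x k + x l}

/-- The union of the hyperplanes of the mid-hyperplane arrangement
`M_m = B_m ∪ N_m`. -/
def midHyperplaneUnion (m : ℕ) : Set (Fin m → ℝ) :=
  braidUnion m ∪ midUnion m

/-- The chamber `C_0 = {x : x_1 < ⋯ < x_m}` of the braid arrangement. -/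
def C0 (m : ℕ) : Set (Fin m → ℝ) := {x | StrictMono x}

/-- The ranking pattern of the unidimensional unfolding model with objects
`x_1, …, x_m ∈ ℝ`: the set of rankings `(i_1 ⋯ i_m)` (permutations of
`{1,…,m}`, where `σ k = i_k`) such that
`|y - x_{i_1}| < ⋯ < |y - x_{i_m}|` for some `y ∈ ℝ`. -/
def RPUF {m : ℕ} (x : Fin m → ℝ) : Set (Equiv.Perm (Fin m)) :=
  {σ | ∃ y : ℝ, ∀ k l : Fin m, k < l → |y - x (σ k)| < |y - x (σ l)|}

/-- The chambers of an arrangement with union of hyperplanes `U`: the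
connected components of the complement of `U`. -/
def chambersOf {m : ℕ} (U : Set (Fin m → ℝ)) : Set (Set (Fin m → ℝ)) :=
  {C | ∃ y ∈ Uᶜ, C = connectedComponentIn Uᶜ y}

/-- `r_0(m)`: the number of ranking patterns of unidimensional unfolding
models with generic `m`-tuples such that `x_1 < ⋯ < x_m`. -/
noncomputable def r0 (m : ℕ) : ℕ :=
  {R : Set (Equiv.Perm (Fin m)) | ∃ x ∈ C0 m \ midUnion m, R = RPUF x}.ncard

/-- A family of sign patterns of linear forms vanishing on a common line, realized on an open
half-space off the hyperplanes, shatters only sets of size at most `finrank ℝ V - 2`. -/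
theorem card_add_two_le_finrank_of_shatters {V α : Type*} [AddCommGroup V] [Module ℝ V]
    [FiniteDimensional ℝ V] [DecidableEq α] (f₀ g : Module.Dual ℝ V) (f : α → Module.Dual ℝ V)
    (e : V) (hg : g e ≠ 0) (hf₀ : f₀ e = 0) (hf : ∀ a, f a e = 0) (𝒜 : Finset (Finset α))
    (h𝒜 : ∀ t ∈ 𝒜, ∃ x, 0 < f₀ x ∧ (∀ a, f a x ≠ 0) ∧ ∀ a, a ∈ t ↔ 0 < f a x)
    (S : Finset α) (hS : 𝒜.Shatters S) : S.card + 2 ≤ Module.finrank ℝ V := by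
  by_contra! hlt
  let w : Option (Option S) → Module.Dual ℝ V := fun o =>
    o.elim g fun o => o.elim f₀ fun a => f a
  have hdep : ¬ LinearIndependent ℝ w := fun h => by
    have := h.fintype_card_le_finrank
    simp only [Fintype.card_option, Fintype.card_coe, Subspace.dual_finrank_eq] at this
    omega
  obtain ⟨c, hc, i, hi⟩ := Fintype.not_linearIndependent_iff.1 hdep
  simp only [Fintype.sum_option, w, Option.elim] at hc
  have heval (x : V) : c none * g x + (c (some none) * f₀ x +
      ∑ a : S, c (some (some a)) * f a x) = 0 := by
    simpa using congrArg (fun φ : Module.Dual ℝ V => φ x) hc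
  have hg0 : c none = 0 := by
    have := heval e
    simp only [hf₀, hf, mul_zero, Finset.sum_const_zero, add_zero, mul_eq_zero] at this
    exact this.resolve_right hg
  have key (d₀ : ℝ) (d : S → ℝ) (hd₀ : 0 ≤ d₀)
      (hd : ∀ x, d₀ * f₀ x + ∑ a, d a * f a x = 0) : d₀ = 0 ∧ ∀ a, d a = 0 := by
    obtain ⟨t, ht, hSt⟩ := @hS ((Finset.univ.filter fun a : S => 0 < d a).map
      (Function.Embedding.subtype _)) (by
        intro a ha
        simp only [Finset.mem_map, Finset.mem_filter, Finset.mem_univ, true_and] at ha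
        obtain ⟨b, -, rfl⟩ := ha
        exact b.2)
    obtain ⟨x, hx₀, hx, hxt⟩ := h𝒜 t ht
    have hsign (a : S) : 0 < d a ↔ 0 < f a x := by
      rw [← hxt]
      have := Finset.ext_iff.1 hSt a
      simpa using this.symm
    have hnonneg (a : S) : 0 ≤ d a * f a x := by
      by_cases ha : 0 < d a
      · exact (mul_pos ha ((hsign a).1 ha)).le
      · exact mul_nonneg_of_nonpos_of_nonpos (not_lt.1 ha) (not_lt.1 fun h => ha ((hsign a).2 h))
    have hsum := Finset.sum_nonneg fun a (_ : a ∈ Finset.univ) => hnonneg a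
    have hprod := mul_nonneg hd₀ hx₀.le
    have hx' := hd x
    refine ⟨?_, fun a => ?_⟩
    · have : d₀ * f₀ x = 0 := by linarith
      exact (mul_eq_zero.1 this).resolve_right hx₀.ne'
    · have h0 : ∑ a, d a * f a x = 0 := by linarith
      have := (Finset.sum_eq_zero_iff_of_nonneg fun a _ => hnonneg a).1 h0 a (Finset.mem_univ _)
      exact (mul_eq_zero.1 this).resolve_right (hx a)
  have hzero : c (some none) = 0 ∧ ∀ a, c (some (some a)) = 0 := by
    rcases le_total 0 (c (some none)) with h | h
    · exact key _ _ h fun x => by simpa [hg0] using heval x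
    · have := key (-c (some none)) (fun a => -c (some (some a))) (neg_nonneg.2 h) fun x => by
        have := heval x
        simp only [hg0, zero_mul, zero_add] at this
        simp only [neg_mul, Finset.sum_neg_distrib]
        linarith
      simpa using this
  rcases i with _ | _ | a
  · exact hi hg0
  · exact hi hzero.1
  · exact hi (hzero.2 a)

/-- The Sauer–Shelah bound for the number of sign patterns of linear forms vanishing on a common
line, on an open half-space. -/
theorem card_signPatterns_le {V α : Type*} [AddCommGroup V] [Module ℝ V]
    [FiniteDimensional ℝ V] [DecidableEq α] [Fintype α] (f₀ g : Module.Dual ℝ V)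
    (f : α → Module.Dual ℝ V) (e : V) (hg : g e ≠ 0) (hf₀ : f₀ e = 0) (hf : ∀ a, f a e = 0)
    (𝒜 : Finset (Finset α))
    (h𝒜 : ∀ t ∈ 𝒜, ∃ x, 0 < f₀ x ∧ (∀ a, f a x ≠ 0) ∧ ∀ a, a ∈ t ↔ 0 < f a x) :
    𝒜.card ≤ ∑ k ∈ Finset.Iic (Module.finrank ℝ V - 2), (Fintype.card α).choose k := by
  refine 𝒜.card_le_card_shatterer.trans (Finset.card_shatterer_le_sum_vcDim.trans ?_)
  refine Finset.sum_le_sum_of_subset (Finset.Iic_subset_Iic.2 (Finset.sup_le fun S hS => ?_))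
  have := card_add_two_le_finrank_of_shatters f₀ g f e hg hf₀ hf 𝒜 h𝒜 S
    (Finset.mem_shatterer.1 hS)
  omega

theorem sum_choose_le_exp_mul_div_pow {N d : ℕ} (hd : 0 < d) (hdN : d ≤ N) :
    ((∑ k ∈ Finset.Iic d, N.choose k : ℕ) : ℝ) ≤ (Real.exp 1 * N / d) ^ d := by
  have hd' : (0 : ℝ) < d := by exact_mod_cast hd
  have hN' : (0 : ℝ) < N := by exact_mod_cast hd.trans_le hdN
  set q : ℝ := d / N with hq
  have hq0 : 0 < q := by positivity
  have hq1 : q ≤ 1 := by rw [hq, div_le_one hN']; exact_mod_cast hdN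
  have hle : ((∑ k ∈ Finset.Iic d, N.choose k : ℕ) : ℝ) * q ^ d ≤ Real.exp 1 ^ d := by
    calc ((∑ k ∈ Finset.Iic d, N.choose k : ℕ) : ℝ) * q ^ d
        = ∑ k ∈ Finset.Iic d, (N.choose k : ℝ) * q ^ d := by push_cast; rw [Finset.sum_mul]
      _ ≤ ∑ k ∈ Finset.Iic d, (N.choose k : ℝ) * q ^ k := by
          refine Finset.sum_le_sum fun k hk => ?_
          have := pow_le_pow_of_le_one hq0.le hq1 (Finset.mem_Iic.1 hk)
          gcongr
      _ ≤ ∑ k ∈ Finset.range (N + 1), (N.choose k : ℝ) * q ^ k := by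
          refine Finset.sum_le_sum_of_subset_of_nonneg (fun k hk => ?_) fun _ _ _ => by positivity
          have := Finset.mem_Iic.1 hk
          exact Finset.mem_range.2 (by omega)
      _ = (q + 1) ^ N := by
          rw [add_pow]
          refine Finset.sum_congr rfl fun k _ => ?_
          rw [one_pow, mul_one, mul_comm]
      _ ≤ Real.exp q ^ N := by
          have := Real.add_one_le_exp q
          gcongr
      _ = Real.exp 1 ^ d := by
          rw [← Real.exp_nat_mul, ← Real.exp_nat_mul, hq]
          congr 1
          field_simp
  have : (Real.exp 1 * N / d) ^ d = Real.exp 1 ^ d / q ^ d := by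
    rw [← div_pow, hq]
    congr 1
    field_simp
  rw [this, le_div_iff₀ (by positivity)]
  exact hle

theorem two_mul_card_filter_of_involution {α : Type*} (s : Finset α) (p : α → Prop)
    [DecidablePred p] (τ : α → α) (hτ : ∀ a, τ (τ a) = a) (hs : ∀ a ∈ s, τ a ∈ s)
    (hp : ∀ a ∈ s, p (τ a) ↔ ¬ p a) : 2 * (s.filter p).card = s.card := by
  rw [← Finset.card_filter_add_card_filter_not (s := s) p, two_mul]
  congr 1
  refine Finset.card_bij (fun a _ => τ a) ?_ ?_ ?_
  · intro a ha
    simp only [Finset.mem_filter] at ha ⊢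
    exact ⟨hs a ha.1, fun h => (hp a ha.1).1 h ha.2⟩
  · intro a _ b _ h
    rw [← hτ a, h, hτ]
  · intro b hb
    simp only [Finset.mem_filter] at hb
    exact ⟨τ b, Finset.mem_filter.2 ⟨hs b hb.1, (hp b hb.1).2 hb.2⟩, hτ b⟩

/-- The pairs `i < j` other than `(a, b)`. -/
def otherPairs {m : ℕ} (a b : Fin m) : Finset (Fin m × Fin m) :=
  Finset.univ.filter fun p => p.1 < p.2 ∧ p ≠ (a, b)

/-- The quadruples indexing the hyperplanes of `N_m`. -/
def midQuads (m : ℕ) : Finset (Fin m × Fin m × Fin m × Fin m) :=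
  Finset.univ.filter fun q =>
    q.1 < q.2.1 ∧ q.1 < q.2.2.1 ∧ q.2.2.1 < q.2.2.2 ∧ q.2.1 ≠ q.2.2.1 ∧ q.2.1 ≠ q.2.2.2

theorem two_mul_card_otherPairs {m : ℕ} {a b : Fin m} (hab : a < b) :
    2 * ((otherPairs a b).card + 1) = m * m - m := by
  have h1 : (otherPairs a b).card + 1 =
      ((Finset.univ : Finset (Fin m)).offDiag.filter fun p => p.1 < p.2).card := by
    have hmem : (a, b) ∈ (Finset.univ : Finset (Fin m)).offDiag.filter fun p => p.1 < p.2 := by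
      simpa using ⟨hab.ne, hab⟩
    rw [← Finset.card_erase_add_one hmem]
    congr 2
    ext p
    simp only [otherPairs, Finset.mem_filter, Finset.mem_univ, true_and, Finset.mem_erase,
      Finset.mem_offDiag]
    grind
  rw [h1, two_mul_card_filter_of_involution _ _ Prod.swap (by simp)]
  · simp [Finset.offDiag_card]
  · intro p hp
    simp only [Finset.mem_offDiag, Finset.mem_univ, true_and, Prod.fst_swap, Prod.snd_swap] at hp ⊢
    exact hp.symm
  · intro p hp
    simp only [Finset.mem_offDiag, Finset.mem_univ, true_and, Prod.fst_swap, Prod.snd_swap] at hp ⊢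
    grind

theorem eight_mul_card_midQuads (m : ℕ) : 8 * (midQuads m).card = m.descFactorial 4 := by
  let D : Finset (Fin m × Fin m × Fin m × Fin m) := Finset.univ.filter fun q =>
    q.1 ≠ q.2.1 ∧ q.1 ≠ q.2.2.1 ∧ q.1 ≠ q.2.2.2 ∧ q.2.1 ≠ q.2.2.1 ∧ q.2.1 ≠ q.2.2.2 ∧
      q.2.2.1 ≠ q.2.2.2
  have hD : D.card = m.descFactorial 4 := by
    have := Fintype.card_embedding_eq (α := Fin 4) (β := Fin m)
    rw [Fintype.card_fin, Fintype.card_fin] at this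
    rw [← this, ← Finset.card_univ]
    symm
    refine Finset.card_bij (fun φ _ => (φ 0, φ 1, φ 2, φ 3)) ?_ ?_ ?_
    · intro φ _
      simp [D, φ.injective.eq_iff]
    · intro φ _ ψ _ h
      simp only [Prod.mk.injEq] at h
      ext i
      fin_cases i <;> simp [h]
    · rintro ⟨i, j, k, l⟩ hq
      simp only [D, Finset.mem_filter, Finset.mem_univ, true_and] at hq
      refine ⟨⟨![i, j, k, l], ?_⟩, Finset.mem_univ _, rfl⟩
      intro x y hxy
      fin_cases x <;> fin_cases y <;> simp at hxy ⊢ <;> grind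
  have h1 := two_mul_card_filter_of_involution D (fun q => q.1 < q.2.1)
    (fun q => (q.2.1, q.1, q.2.2)) (by simp) (by simp only [D]; grind) (by simp only [D]; grind)
  have h2 := two_mul_card_filter_of_involution (D.filter fun q => q.1 < q.2.1)
    (fun q => q.2.2.1 < q.2.2.2)
    (fun q => (q.1, q.2.1, q.2.2.2, q.2.2.1)) (by simp) (by simp only [D]; grind)
    (by simp only [D]; grind)
  have h3 := two_mul_card_filter_of_involution
    ((D.filter fun q => q.1 < q.2.1).filter fun q => q.2.2.1 < q.2.2.2)
    (fun q => q.1 < q.2.2.1)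
    (fun q => (q.2.2.1, q.2.2.2, q.1, q.2.1)) (by simp) (by simp only [D]; grind)
    (by simp only [D]; grind)
  have h4 : midQuads m = ((D.filter fun q => q.1 < q.2.1).filter
      fun q => q.2.2.1 < q.2.2.2).filter fun q => q.1 < q.2.2.1 := by
    ext q
    simp only [midQuads, D, Finset.mem_filter, Finset.mem_univ, true_and]
    grind
  rw [h4]
  omega

theorem two_mul_card_perm_lt {m : ℕ} {a b : Fin m} (hab : a < b) :
    2 * (Finset.univ.filter fun σ : Equiv.Perm (Fin m) => σ a < σ b).card = m.factorial := by
  rw [two_mul_card_filter_of_involution _ _ (fun σ => σ * Equiv.swap a b)]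
  · simp [Fintype.card_perm]
  · intro σ
    simp [mul_assoc]
  · simp
  · intro σ _
    have : σ a ≠ σ b := σ.injective.ne hab.ne
    simp only [Equiv.Perm.mul_apply, Equiv.swap_apply_left, Equiv.swap_apply_right, not_lt]
    exact ⟨le_of_lt, fun h => lt_of_le_of_ne h this.symm⟩

theorem forall_distinct_of_midQuads {m : ℕ} (P : Fin m → Fin m → Fin m → Fin m → Prop)
    (hleft : ∀ i j k l, P i j k l → P j i k l) (hright : ∀ i j k l, P i j k l → P i j l k)
    (hswap : ∀ i j k l, P i j k l → P k l i j)
    (h : ∀ q ∈ midQuads m, P q.1 q.2.1 q.2.2.1 q.2.2.2) (i j k l : Fin m) (hij : i ≠ j)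
    (hik : i ≠ k) (hil : i ≠ l) (hjk : j ≠ k) (hjl : j ≠ l) (hkl : k ≠ l) : P i j k l := by
  have base : ∀ i j k l : Fin m, i ≠ k → i ≠ l → j ≠ k → j ≠ l → i < j → k < l →
      P i j k l := by
    intro i j k l hik hil hjk hjl hij hkl
    rcases hik.lt_or_gt with hik' | hik'
    · exact h (i, j, k, l) (by simp [midQuads]; grind)
    · exact hswap _ _ _ _ (h (k, l, i, j) (by simp [midQuads]; grind))
  have base' : ∀ i j k l : Fin m, i ≠ k → i ≠ l → j ≠ k → j ≠ l → i < j → k ≠ l →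
      P i j k l := by
    intro i j k l hik hil hjk hjl hij hkl
    rcases hkl.lt_or_gt with hkl' | hkl'
    · exact base i j k l hik hil hjk hjl hij hkl'
    · exact hright _ _ _ _ (base i j l k hil hik hjl hjk hij hkl')
  rcases hij.lt_or_gt with hij' | hij'
  · exact base' i j k l hik hil hjk hjl hij' hkl
  · exact hleft _ _ _ _ (base' j i k l hjk hjl hik hil hij' hkl)

theorem notMem_midUnion_iff {m : ℕ} {x : Fin m → ℝ} :
    x ∉ midUnion m ↔ ∀ q ∈ midQuads m, x q.1 + x q.2.1 ≠ x q.2.2.1 + x q.2.2.2 := by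
  simp only [midUnion, midQuads, Set.mem_iUnion, Set.mem_ofPred_eq, Finset.mem_filter,
    Finset.mem_univ, true_and, not_exists, Prod.forall]
  grind

theorem add_ne_add_of_notMem_midUnion {m : ℕ} {x : Fin m → ℝ} (hx : x ∉ midUnion m)
    (i j k l : Fin m) (hij : i ≠ j) (hik : i ≠ k) (hil : i ≠ l) (hjk : j ≠ k) (hjl : j ≠ l)
    (hkl : k ≠ l) : x i + x j ≠ x k + x l := by
  refine forall_distinct_of_midQuads (fun i j k l => x i + x j ≠ x k + x l) ?_ ?_ ?_
    (notMem_midUnion_iff.1 hx) i j k l hij hik hil hjk hjl hkl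
  · intro i j k l h
    rwa [add_comm (x j)]
  · intro i j k l h
    rwa [add_comm (x l)]
  · intro i j k l h
    exact h.symm

/-- Two points order all midpoints of pairs alike as soon as they order the coordinates alike
and lie on the same sides of the hyperplanes of `N_m`. -/
theorem add_lt_add_iff_of_signs {m : ℕ} {u v : Fin m → ℝ} (huv : ∀ i j, u i < u j ↔ v i < v j)
    (hu : u ∉ midUnion m) (hv : v ∉ midUnion m)
    (h : ∀ q ∈ midQuads m, u q.1 + u q.2.1 < u q.2.2.1 + u q.2.2.2 ↔
      v q.1 + v q.2.1 < v q.2.2.1 + v q.2.2.2)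
    (i j k l : Fin m) (hij : i ≠ j) (hkl : k ≠ l) :
    u i + u j < u k + u l ↔ v i + v j < v k + v l := by
  by_cases hik : i = k
  · subst hik
    simpa using huv j l
  by_cases hil : i = l
  · subst hil
    rw [add_comm (u k), add_comm (v k)]
    simpa using huv j k
  by_cases hjk : j = k
  · subst hjk
    rw [add_comm (u i), add_comm (v i)]
    simpa using huv i l
  by_cases hjl : j = l
  · subst hjl
    simpa using huv i k
  refine (forall_distinct_of_midQuads
    (fun i j k l => (u i + u j < u k + u l ↔ v i + v j < v k + v l) ∧
      (u k + u l < u i + u j ↔ v k + v l < v i + v j)) ?_ ?_ ?_ ?_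
    i j k l hij hik hil hjk hjl hkl).1
  · intro i j k l h
    rwa [add_comm (u j), add_comm (v j)]
  · intro i j k l h
    rwa [add_comm (u l), add_comm (v l)]
  · intro i j k l h
    exact h.symm
  · intro q hq
    refine ⟨h q hq, ?_⟩
    have h1 := notMem_midUnion_iff.1 hu q hq
    have h2 := notMem_midUnion_iff.1 hv q hq
    have h3 := h q hq
    rw [← not_le, ← not_le, le_iff_lt_or_eq, le_iff_lt_or_eq, h3]
    simp [h1, h2]

theorem abs_sub_lt_abs_sub_iff_of_lt {a b y : ℝ} (h : a < b) :
    |y - a| < |y - b| ↔ y < (a + b) / 2 := by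
  rw [← sq_lt_sq]
  constructor <;> intro h' <;> nlinarith

theorem abs_sub_lt_abs_sub_iff_of_gt {a b y : ℝ} (h : b < a) :
    |y - a| < |y - b| ↔ (a + b) / 2 < y := by
  rw [← sq_lt_sq]
  constructor <;> intro h' <;> nlinarith

theorem RPUF_subset_of_add_lt_add {m : ℕ} {x x' : Fin m → ℝ} (hx : x ∈ C0 m) (hx' : x' ∈ C0 m)
    (h : ∀ i j k l : Fin m, i ≠ j → k ≠ l → x i + x j < x k + x l → x' i + x' j < x' k + x' l) :
    RPUF x ⊆ RPUF x' := by
  rintro σ ⟨y, hy⟩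
  let lo : Finset (Fin m × Fin m) := Finset.univ.filter fun p => p.1 < p.2 ∧ σ p.2 < σ p.1
  let hi : Finset (Fin m × Fin m) := Finset.univ.filter fun p => p.1 < p.2 ∧ σ p.1 < σ p.2
  let mid : Fin m × Fin m → ℝ := fun p => (x' (σ p.1) + x' (σ p.2)) / 2
  obtain ⟨z, hlo, hhi⟩ := Order.exists_between_finsets (lo.image mid) (hi.image mid) (by
    simp only [Finset.mem_image, lo, hi, Finset.mem_filter, Finset.mem_univ, true_and]
    rintro _ ⟨p, ⟨hp, hpσ⟩, rfl⟩ _ ⟨q, ⟨hq, hqσ⟩, rfl⟩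
    have h1 := (abs_sub_lt_abs_sub_iff_of_gt (hx hpσ)).1 (hy _ _ hp)
    have h2 := (abs_sub_lt_abs_sub_iff_of_lt (hx hqσ)).1 (hy _ _ hq)
    have := h (σ p.1) (σ p.2) (σ q.1) (σ q.2) hpσ.ne' hqσ.ne (by linarith)
    simp only [mid]
    linarith)
  refine ⟨z, fun k l hkl => ?_⟩
  rcases (σ.injective.ne hkl.ne).lt_or_gt with hσ | hσ
  · rw [abs_sub_lt_abs_sub_iff_of_lt (hx' hσ)]
    exact hhi _ (Finset.mem_image_of_mem mid (a := (k, l)) (by simpa [hi] using ⟨hkl, hσ⟩))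
  · rw [abs_sub_lt_abs_sub_iff_of_gt (hx' hσ)]
    exact hlo _ (Finset.mem_image_of_mem mid (a := (k, l)) (by simpa [lo] using ⟨hkl, hσ⟩))

theorem RPUF_eq_of_add_lt_add_iff {m : ℕ} {x x' : Fin m → ℝ} (hx : x ∈ C0 m) (hx' : x' ∈ C0 m)
    (h : ∀ i j k l : Fin m, i ≠ j → k ≠ l →
      (x i + x j < x k + x l ↔ x' i + x' j < x' k + x' l)) : RPUF x = RPUF x' :=
  (RPUF_subset_of_add_lt_add hx hx' fun i j k l hij hkl => (h i j k l hij hkl).1).antisymm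
    (RPUF_subset_of_add_lt_add hx' hx fun i j k l hij hkl => (h i j k l hij hkl).2)

theorem perm_eq_of_lt_iff_lt {m : ℕ} {σ τ : Equiv.Perm (Fin m)}
    (h : ∀ i j, σ i < σ j ↔ τ i < τ j) : σ = τ := by
  let e : Fin m ≃o Fin m := (show StrictMono (τ * σ⁻¹) from fun i j hij => by
    simpa using (h (σ⁻¹ i) (σ⁻¹ j)).1 (by simpa using hij)).orderIsoOfSurjective _
      (τ * σ⁻¹).surjective
  have he : e = OrderIso.refl _ := Subsingleton.elim _ _
  ext i
  have := congrArg (fun f : Fin m ≃o Fin m => f (σ i)) he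
  simpa [e] using congrArg Fin.val this.symm

theorem comp_perm_notMem_midUnion {m : ℕ} {x : Fin m → ℝ} (hx : x ∉ midUnion m)
    (σ : Equiv.Perm (Fin m)) : x ∘ σ ∉ midUnion m := by
  refine notMem_midUnion_iff.2 fun q hq => ?_
  simp only [midQuads, Finset.mem_filter, Finset.mem_univ, true_and] at hq
  simp only [Function.comp_apply]
  apply add_ne_add_of_notMem_midUnion hx <;> apply σ.injective.ne <;> grind

/-- The `i`-th coordinate, as a linear form. -/
def coordForm {m : ℕ} (i : Fin m) : Module.Dual ℝ (Fin m → ℝ) := LinearMap.proj i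

@[simp]
theorem coordForm_apply {m : ℕ} (i : Fin m) (x : Fin m → ℝ) : coordForm i x = x i := rfl

/-- The linear forms defining the hyperplanes of `M_m` other than `x_a = x_b`. -/
noncomputable def otherForm {m : ℕ} (a b : Fin m) :
    otherPairs a b ⊕ midQuads m → Module.Dual ℝ (Fin m → ℝ)
  | .inl p => coordForm p.1.2 - coordForm p.1.1
  | .inr q => coordForm q.1.2.2.1 + coordForm q.1.2.2.2 -
      (coordForm q.1.1 + coordForm q.1.2.1)

open scoped Classical in
/-- The linear forms in `otherForm a b` that are positive at `x`. -/
noncomputable def signPattern {m : ℕ} (a b : Fin m) (x : Fin m → ℝ) :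
    Finset (otherPairs a b ⊕ midQuads m) :=
  Finset.univ.filter fun i => 0 < otherForm a b i x

theorem inl_mem_signPattern {m : ℕ} {a b : Fin m} {x : Fin m → ℝ} {p : otherPairs a b} :
    Sum.inl p ∈ signPattern a b x ↔ x p.1.1 < x p.1.2 := by
  simp only [signPattern, Finset.mem_filter]
  simp [otherForm]

theorem inr_mem_signPattern {m : ℕ} {a b : Fin m} {x : Fin m → ℝ} {q : midQuads m} :
    Sum.inr q ∈ signPattern a b x ↔ x q.1.1 + x q.1.2.1 < x q.1.2.2.1 + x q.1.2.2.2 := by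
  simp only [signPattern, Finset.mem_filter]
  simp [otherForm]

theorem eq_of_signPattern_comp_eq {m : ℕ} {a b : Fin m} {x x' : Fin m → ℝ}
    (hx : x ∈ C0 m \ midUnion m) (hx' : x' ∈ C0 m \ midUnion m) {σ τ : Equiv.Perm (Fin m)}
    (hσ : σ a < σ b) (hτ : τ a < τ b)
    (h : signPattern a b (x ∘ σ) = signPattern a b (x' ∘ τ)) : σ = τ ∧ RPUF x = RPUF x' := by
  have hlt : ∀ i j, i < j → (σ i < σ j ↔ τ i < τ j) := by
    intro i j hij
    by_cases hab : (i, j) = (a, b)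
    · obtain ⟨rfl, rfl⟩ := Prod.mk.inj hab
      simp [hσ, hτ]
    · have := Finset.ext_iff.1 h
        (.inl ⟨(i, j), by simpa [otherPairs] using ⟨hij, by simpa using hab⟩⟩)
      simpa [inl_mem_signPattern, hx.1.lt_iff_lt, hx'.1.lt_iff_lt] using this
  have hστ : σ = τ := by
    refine perm_eq_of_lt_iff_lt fun i j => ?_
    rcases lt_trichotomy i j with hij | rfl | hij
    · exact hlt i j hij
    · simp
    · have h1 := hlt j i hij
      have h2 := σ.injective.ne hij.ne
      have h3 := τ.injective.ne hij.ne
      grind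
  subst hστ
  refine ⟨rfl, RPUF_eq_of_add_lt_add_iff hx.1 hx'.1 fun i j k l hij hkl => ?_⟩
  have := add_lt_add_iff_of_signs (u := x ∘ σ) (v := x' ∘ σ)
    (fun i j => by simp [hx.1.lt_iff_lt, hx'.1.lt_iff_lt])
    (comp_perm_notMem_midUnion hx.2 σ) (comp_perm_notMem_midUnion hx'.2 σ)
    (fun q hq => by
      have := Finset.ext_iff.1 h (.inr ⟨q, hq⟩)
      simpa only [inr_mem_signPattern] using this)
    (σ⁻¹ i) (σ⁻¹ j) (σ⁻¹ k) (σ⁻¹ l) (by simpa using hij) (by simpa using hkl)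
  simpa using this

theorem otherForm_comp_ne_zero {m : ℕ} {a b : Fin m} {x : Fin m → ℝ}
    (hx : x ∈ C0 m \ midUnion m) (σ : Equiv.Perm (Fin m)) (i : otherPairs a b ⊕ midQuads m) :
    otherForm a b i (x ∘ σ) ≠ 0 := by
  rcases i with ⟨p, hp⟩ | ⟨q, hq⟩
  · simp only [otherPairs, Finset.mem_filter] at hp
    have := (hx.1.injective.comp σ.injective).ne hp.2.1.ne'
    simpa [otherForm, sub_eq_zero] using this
  · have := notMem_midUnion_iff.1 (comp_perm_notMem_midUnion hx.2 σ) q hq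
    simpa [otherForm, sub_eq_zero] using this.symm

theorem factorial_mul_r0_le {m : ℕ} {a b : Fin m} (hab : a < b) :
    m.factorial * r0 m ≤ 2 * ∑ k ∈ Finset.Iic (m - 2),
      ((otherPairs a b).card + (midQuads m).card).choose k := by
  classical
  set Rs : Set (Set (Equiv.Perm (Fin m))) := {R | ∃ x ∈ C0 m \ midUnion m, R = RPUF x}
  choose! x hx hxR using show ∀ R ∈ Rs, ∃ x ∈ C0 m \ midUnion m, R = RPUF x from fun _ h => h
  let pairs := (Finset.univ.filter fun σ : Equiv.Perm (Fin m) => σ a < σ b) ×ˢ Rs.toFinset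
  let pattern : Equiv.Perm (Fin m) × Set (Equiv.Perm (Fin m)) →
      Finset (otherPairs a b ⊕ midQuads m) := fun p => signPattern a b (x p.2 ∘ p.1)
  have hmem : ∀ p ∈ pairs, p.1 a < p.1 b ∧ p.2 ∈ Rs := by simp [pairs]
  have hinj : Set.InjOn pattern pairs := by
    rintro ⟨σ, R⟩ hp ⟨τ, R'⟩ hp' h
    obtain ⟨hσ, hR⟩ := hmem _ hp
    obtain ⟨hτ, hR'⟩ := hmem _ hp'
    obtain ⟨h1, h2⟩ := eq_of_signPattern_comp_eq (hx R hR) (hx R' hR') hσ hτ h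
    rw [← hxR R hR, ← hxR R' hR'] at h2
    exact Prod.ext h1 h2
  have hcard : (pairs.image pattern).card ≤ _ := card_signPatterns_le
    (coordForm b - coordForm a) (coordForm a) (otherForm a b) (fun _ => 1)
    (by simp) (by simp) (by rintro (p | q) <;> simp [otherForm]) (pairs.image pattern) (by
      intro t ht
      obtain ⟨⟨σ, R⟩, hp, rfl⟩ := Finset.mem_image.1 ht
      obtain ⟨hσ, hR⟩ := hmem _ hp
      refine ⟨x R ∘ σ, by simpa using (hx R hR).1 hσ, otherForm_comp_ne_zero (hx R hR) σ,
        fun i => by simp [pattern, signPattern]⟩)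
  rw [Finset.card_image_of_injOn hinj] at hcard
  simp only [pairs, Finset.card_product, Fintype.card_sum, Fintype.card_coe,
    Module.finrank_fintype_fun_eq_card, Fintype.card_fin] at hcard
  rw [← two_mul_card_perm_lt hab, show r0 m = Rs.toFinset.card from
    Set.ncard_eq_toFinset_card' Rs, mul_assoc]
  exact Nat.mul_le_mul_left 2 hcard

/-- Upper bound: for all `m ≥ 4`, `r_0(m) < (2/m!)·(e·m·(m-1)²/8)^{m-2}`. -/
theorem r0_upper_bound (m : ℕ) (hm : 4 ≤ m) :
    (r0 m : ℝ) <
      2 / (Nat.factorial m : ℝ) *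
        (Real.exp 1 * (m : ℝ) * ((m : ℝ) - 1) ^ 2 / 8) ^ (m - 2) := by
  have hab : (⟨0, by omega⟩ : Fin m) < ⟨1, by omega⟩ := by simp
  have hcount := factorial_mul_r0_le hab
  have hpairs := two_mul_card_otherPairs hab
  have hquads := eight_mul_card_midQuads m
  generalize (otherPairs (⟨0, by omega⟩ : Fin m) ⟨1, by omega⟩).card = p at hcount hpairs
  generalize (midQuads m).card = q at hcount hquads
  obtain ⟨d, rfl⟩ := Nat.exists_eq_add_of_le' (show 2 ≤ m by omega)
  have hd : 2 ≤ d := by omega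
  rw [Nat.add_sub_cancel] at hcount ⊢
  have hpairs' : 2 * (p + 1) = (d + 2) * (d + 1) := by
    rw [hpairs, Nat.sub_eq_iff_eq_add (Nat.le_mul_self _)]
    ring
  have hquads' : 8 * q = (d + 2) * (d + 1) * d * (d - 1) := by
    rw [hquads]
    simp only [Nat.descFactorial, Nat.add_sub_cancel, Nat.sub_zero,
      show d + 2 - 1 = d + 1 by omega, show d + 2 - 3 = d - 1 by omega]
    ring
  obtain ⟨c, rfl⟩ := Nat.exists_eq_add_of_le' (show 1 ≤ d by omega)
  have hc : 1 ≤ c := by omega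
  rw [Nat.add_sub_cancel] at hquads'
  have hdN : c + 1 ≤ p + q := by nlinarith
  have hN : 8 * (p + q) < (c + 3) * (c + 2) ^ 2 * (c + 1) := by nlinarith [Nat.zero_le (c ^ 3)]
  have hsum := sum_choose_le_exp_mul_div_pow (show 0 < c + 1 by omega) hdN
  have hcount' : ((c + 1 + 2).factorial : ℝ) * r0 (c + 1 + 2) ≤
      2 * ((∑ k ∈ Finset.Iic (c + 1), (p + q).choose k : ℕ) : ℝ) := by exact_mod_cast hcount
  have hbase : Real.exp 1 * ((p + q : ℕ) : ℝ) / ((c + 1 : ℕ) : ℝ) <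
      Real.exp 1 * ((c + 1 + 2 : ℕ) : ℝ) * (((c + 1 + 2 : ℕ) : ℝ) - 1) ^ 2 / 8 := by
    have hN' : (8 : ℝ) * ((p + q : ℕ) : ℝ) < (c + 3) * (c + 2) ^ 2 * (c + 1) := by
      exact_mod_cast hN
    have := mul_lt_mul_of_pos_left hN' (Real.exp_pos 1)
    rw [div_lt_div_iff₀ (by positivity) (by norm_num)]
    push_cast at this ⊢
    linarith
  have hpow := pow_lt_pow_left₀ hbase (by positivity) (show c + 1 ≠ 0 by omega)
  rw [div_mul_eq_mul_div, lt_div_iff₀ (by positivity), mul_comm]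
  linarith
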